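/- arXiv:2605.21636 — 2 statements merged into one kernel-verified Lean document; each statement's English description precedes it below -/
import Mathlib

section
/- For every nonempty σ ⊆ X and every (p,r) ∈ ℝ² × [0,∞): the intersection ⋂_{x ∈ σ} TelVor(x)_{p,r} is nonempty if and only if σ ∈ Incr(γ), γ(σ) ≤ p, and ω_σ ≤ r. -/
noncomputable section

attribute [local instance] Classical.propDecidable

/-- Euclidean space ℝ^d. -/
abbrev Pt (d : ℕ) := EuclideanSpace ℝ (Fin d)

variable {d : ℕ}

/-- The sphere with center `c` and radius `r` is a circumsphere of the finite set `Q`: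
every point of `Q` lies on it. -/
def OnSphere (c : Pt d) (r : ℝ) (Q : Finset (Pt d)) : Prop :=
  ∀ w ∈ Q, ‖w - c‖ = r

/-- The sphere with center `c` and radius `r` is `Z`-empty: no point of `Z` lies inside it. -/
def SphEmpty (c : Pt d) (r : ℝ) (Z : Finset (Pt d)) : Prop :=
  ∀ z ∈ Z, ¬ ‖z - c‖ < r

/-- The Delaunay triangulation of `Z`: nonempty subsets of `Z` admitting a `Z`-empty
circumsphere. -/
def DelT (Z : Finset (Pt d)) : Set (Finset (Pt d)) :=
  {σ | σ.Nonempty ∧ σ ⊆ Z ∧ ∃ c r, 0 ≤ r ∧ OnSphere c r σ ∧ SphEmpty c r Z}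

/-- `Z` is in general position: every nonempty subset `Q` of at most `d+1` points is affinely
independent, and no point of `Z \ Q` lies on the smallest circumsphere of `Q`. -/
def GenPos (Z : Finset (Pt d)) : Prop :=
  ∀ Q : Finset (Pt d), Q ⊆ Z → Q.Nonempty → Q.card ≤ d + 1 →
    (AffineIndependent ℝ (fun q : ↥(Q : Set (Pt d)) => (q : Pt d))) ∧
    ∀ c r, 0 ≤ r → OnSphere c r Q →
      (∀ c' r', 0 ≤ r' → OnSphere c' r' Q → r ≤ r') →
      ∀ z ∈ Z, z ∉ Q → ‖z - c‖ ≠ r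

/-- The sublevel set `X_p = {x ∈ X : γ(x) ≤ p}` (product order on `ℝ²`). -/
def Xsub (X : Finset (Pt d)) (γ : Pt d → ℝ × ℝ) (p : ℝ × ℝ) : Finset (Pt d) :=
  X.filter fun z => γ z ≤ p

/-- `x` is the point of `σ` with largest `γ₁`-value. -/
def IsMax1 (γ : Pt d → ℝ × ℝ) (σ : Finset (Pt d)) (x : Pt d) : Prop :=
  x ∈ σ ∧ ∀ z ∈ σ, (γ z).1 ≤ (γ x).1

/-- `y` is the point of `σ` with largest `γ₂`-value. -/
def IsMax2 (γ : Pt d → ℝ × ℝ) (σ : Finset (Pt d)) (y : Pt d) : Prop :=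
  y ∈ σ ∧ ∀ z ∈ σ, (γ z).2 ≤ (γ y).2

/-- The sphere of center `c` and radius `r` is a witness of `σ`, where `x = max₁(σ)` and
`y = max₂(σ)`: it is a circumsphere of `σ \ {x,y}`, `x` and `y` lie inside or on it, and it is
`(X_{γ(σ)} \ {x,y})`-empty (note `γ(σ) = (γ₁ x, γ₂ y)`). -/
def IsWitness (X : Finset (Pt d)) (γ : Pt d → ℝ × ℝ) (σ : Finset (Pt d))
    (x y c : Pt d) (r : ℝ) : Prop :=
  (∀ z ∈ σ, z ≠ x → z ≠ y → ‖z - c‖ = r) ∧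
  ‖x - c‖ ≤ r ∧ ‖y - c‖ ≤ r ∧
  ∀ w ∈ Xsub X γ ((γ x).1, (γ y).2), w ≠ x → w ≠ y → ¬ ‖w - c‖ < r

/-- The incremental Delaunay complex `Incr(γ)`: nonempty subsets of `X` admitting a witness. -/
def Incr (X : Finset (Pt d)) (γ : Pt d → ℝ × ℝ) : Set (Finset (Pt d)) :=
  {σ | σ.Nonempty ∧ σ ⊆ X ∧
    ∃ x y c r, IsMax1 γ σ x ∧ IsMax2 γ σ y ∧ 0 ≤ r ∧ IsWitness X γ σ x y c r}

/-- The incremental Delaunay radius `ω_σ`: the minimum radius of a witness of `σ`. -/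
def omegaRad (X : Finset (Pt d)) (γ : Pt d → ℝ × ℝ) (σ : Finset (Pt d)) : ℝ :=
  sInf {r | 0 ≤ r ∧ ∃ x y c, IsMax1 γ σ x ∧ IsMax2 γ σ y ∧ IsWitness X γ σ x y c r}

/-- `γ(σ)`: the coordinatewise maximum of `γ` over the nonempty finite set `σ`. -/
def gammaJoin (γ : Pt d → ℝ × ℝ) (σ : Finset (Pt d)) (h : σ.Nonempty) : ℝ × ℝ :=
  (σ.sup' h fun z => (γ z).1, σ.sup' h fun z => (γ z).2)

/-- `(σ, x)` is a conflict pair at `p ∈ Grid(γ)`: `σ` is a `d`-simplex of `DelT(X_p)`, `x` lies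
inside the circumsphere of `σ`, and either `p₁ < max(im γ₁)` and `x ∈ X_{p→}`, or
`p₂ < max(im γ₂)` and `x ∈ X_{p↑}` (the successor being expressed by its defining property). -/
def ConflictAt (X : Finset (Pt d)) (γ : Pt d → ℝ × ℝ) (p : ℝ × ℝ)
    (σ : Finset (Pt d)) (x : Pt d) : Prop :=
  p.1 ∈ X.image (fun z => (γ z).1) ∧ p.2 ∈ X.image (fun z => (γ z).2) ∧
  σ ∈ DelT (Xsub X γ p) ∧ σ.card = d + 1 ∧
  (∃ c r, 0 ≤ r ∧ OnSphere c r σ ∧ ‖x - c‖ < r) ∧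
  ((∃ a ∈ X.image (fun z => (γ z).1), p.1 < a ∧
      (∀ b ∈ X.image (fun z => (γ z).1), p.1 < b → a ≤ b) ∧
      x ∈ Xsub X γ (a, p.2)) ∨
   (∃ a ∈ X.image (fun z => (γ z).2), p.2 < a ∧
      (∀ b ∈ X.image (fun z => (γ z).2), p.2 < b → a ≤ b) ∧
      x ∈ Xsub X γ (p.1, a)))

/-- `(σ, x)` is a conflict pair: it is a conflict pair at some `p ∈ Grid(γ)`. -/
def ConflictPair (X : Finset (Pt d)) (γ : Pt d → ℝ × ℝ)
    (σ : Finset (Pt d)) (x : Pt d) : Prop :=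
  ∃ p, ConflictAt X γ p σ x

/-- `Δ` witnesses the Δ-property of `X`: `Δ` consists of `d+1` points of `X` which come first in
both the `γ₁`- and `γ₂`-orders, the two orders agree on `Δ`, and `X` is contained in the convex
hull of `Δ`. -/
def IsDelta (X : Finset (Pt d)) (γ : Pt d → ℝ × ℝ) (Δ : Finset (Pt d)) : Prop :=
  Δ ⊆ X ∧ Δ.card = d + 1 ∧
  (∀ a ∈ Δ, ∀ b ∈ X, b ∉ Δ → (γ a).1 < (γ b).1 ∧ (γ a).2 < (γ b).2) ∧
  (∀ a ∈ Δ, ∀ b ∈ Δ, ((γ a).1 ≤ (γ b).1 ↔ (γ a).2 ≤ (γ b).2)) ∧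
  (↑X : Set (Pt d)) ⊆ convexHull ℝ (↑Δ : Set (Pt d))

/-- The Voronoi cell of `x` with respect to `Y`. -/
def VorCell (x : Pt d) (Y : Set (Pt d)) : Set (Pt d) :=
  {w | ∀ y ∈ Y, ‖w - x‖ ≤ ‖w - y‖}

/-- The telescopic Voronoi cell `Tel(x)`: the closure of `⋃_{q ≥ γ(x)} Vor(x, X_q) × {q}`. -/
def Tel (X : Finset (Pt d)) (γ : Pt d → ℝ × ℝ) (x : Pt d) : Set (Pt d × (ℝ × ℝ)) :=
  closure {z | γ x ≤ z.2 ∧ z.1 ∈ VorCell x (↑(Xsub X γ z.2) : Set (Pt d))}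

/-- The telescopic Voronoi ball `TelVor(x)_{p,r}`. -/
def TelVor (X : Finset (Pt d)) (γ : Pt d → ℝ × ℝ) (x : Pt d) (p : ℝ × ℝ) (r : ℝ) :
    Set (Pt d × (ℝ × ℝ)) :=
  Tel X γ x ∩ {z | z.1 ∈ Metric.closedBall x r ∧ z.2 ≤ p}

/-- The telescopic Voronoi cell `TelVor(x)_{p,∞}`. -/
def TelVorInf (X : Finset (Pt d)) (γ : Pt d → ℝ × ℝ) (x : Pt d) (p : ℝ × ℝ) :
    Set (Pt d × (ℝ × ℝ)) :=
  Tel X γ x ∩ {z | z.2 ≤ p}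

/-- The radius of the smallest enclosing ball of `σ`. -/
def miniballRadius (σ : Finset (Pt d)) : ℝ :=
  sInf {r | 0 ≤ r ∧ ∃ c : Pt d, ∀ x ∈ σ, ‖x - c‖ ≤ r}

/-- The Delaunay radius `b_σ`: the minimum radius of a `Z`-empty circumsphere of `σ`. -/
def delRad (Z σ : Finset (Pt d)) : ℝ :=
  sInf {r | 0 ≤ r ∧ ∃ c, OnSphere c r σ ∧ SphEmpty c r Z}

/-- The telescopic offset `TelOffset_{p,r} ⊆ ℝ^d × ℝ²`. -/
def TelOffsetSet (X : Finset (Pt d)) (γ : Pt d → ℝ × ℝ) (p : ℝ × ℝ) (r : ℝ) :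
    Set (Pt d × (ℝ × ℝ)) :=
  ⋃ x ∈ X, Metric.closedBall x r ×ˢ {q : ℝ × ℝ | γ x ≤ q ∧ q ≤ p}

/-- The sublevel offset `Offset_{p,r} ⊆ ℝ^d`. -/
def OffsetSet (X : Finset (Pt d)) (γ : Pt d → ℝ × ℝ) (p : ℝ × ℝ) (r : ℝ) : Set (Pt d) :=
  ⋃ x ∈ Xsub X γ p, Metric.closedBall x r

/-- `OU_r = ⋃_{x ∈ X} Ball_r(x) × Vor(x,X) ⊆ ℝ^d × ℝ^d`. -/
def OUSet (X : Finset (Pt d)) (r : ℝ) : Set (Pt d × Pt d) :=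
  ⋃ x ∈ X, Metric.closedBall x r ×ˢ VorCell x (↑X : Set (Pt d))

/-- `Offset(X)_r = ⋃_{x ∈ X} Ball_r(x) ⊆ ℝ^d`. -/
def OffsetR (X : Finset (Pt d)) (r : ℝ) : Set (Pt d) :=
  ⋃ x ∈ X, Metric.closedBall x r

/-- `OTelDC_{p,r} ⊆ ℝ^d × ℝ^d × ℝ²`. -/
def OTelDCSet (X : Finset (Pt d)) (γ : Pt d → ℝ × ℝ) (p : ℝ × ℝ) (r : ℝ) :
    Set (Pt d × Pt d × (ℝ × ℝ)) :=
  {z | z.2.2 ≤ p ∧ ∃ x ∈ Xsub X γ z.2.2,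
    ‖x - z.1‖ ≤ r ∧ z.2.1 ∈ VorCell x (↑(Xsub X γ z.2.2) : Set (Pt d))}

/-- Explicit description of `Tel(x)`: a point `(w, q)` lies in it iff `γ(x) ≤ q` and `w` is at
least as close to `x` as to every point of `X` whose grade is strictly below `q` in both
coordinates. -/
theorem mem_Tel_iff {X : Finset (Pt d)} {γ : Pt d → ℝ × ℝ}
    (hinj1 : Set.InjOn (fun z => (γ z).1) (↑X : Set (Pt d)))
    (hinj2 : Set.InjOn (fun z => (γ z).2) (↑X : Set (Pt d)))
    {x : Pt d} (hx : x ∈ X) (z : Pt d × (ℝ × ℝ)) :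
    z ∈ Tel X γ x ↔ γ x ≤ z.2 ∧
      ∀ u ∈ X, (γ u).1 < z.2.1 → (γ u).2 < z.2.2 → ‖z.1 - x‖ ≤ ‖z.1 - u‖ := by
  constructor
  · intro hz
    have hclosed : IsClosed {z : Pt d × (ℝ × ℝ) | γ x ≤ z.2 ∧
        ∀ u ∈ X, (γ u).1 < z.2.1 → (γ u).2 < z.2.2 → ‖z.1 - x‖ ≤ ‖z.1 - u‖} := by
      refine IsClosed.and (isClosed_le continuous_const continuous_snd) ?_
      simp only [Set.ofPred_forall]
      refine isClosed_biInter fun u _ => ?_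
      refine isClosed_imp (isOpen_lt (by fun_prop) (by fun_prop)) ?_
      exact isClosed_imp (isOpen_lt (by fun_prop) (by fun_prop))
        (isClosed_le (by fun_prop) (by fun_prop))
    refine closure_minimal ?_ hclosed hz
    rintro ⟨w, q⟩ ⟨hq, hw⟩
    refine ⟨hq, fun u hu h1 h2 => hw u ?_⟩
    simp only [Xsub, Finset.coe_filter, Set.mem_ofPred_eq]
    exact ⟨hu, h1.le, h2.le⟩
  · obtain ⟨w, q⟩ := z
    rintro ⟨hq, hw⟩
    have hlim : Filter.Tendsto
        (fun t : ℝ => (w, (q.1 - t * (q.1 - (γ x).1), q.2 - t * (q.2 - (γ x).2))))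
        (nhdsWithin 0 (Set.Ioi 0)) (nhds (w, q)) := by
      have hcont : Continuous
          (fun t : ℝ => (w, (q.1 - t * (q.1 - (γ x).1), q.2 - t * (q.2 - (γ x).2)))) := by
        fun_prop
      simpa using (hcont.tendsto 0).mono_left nhdsWithin_le_nhds
    refine mem_closure_of_tendsto hlim ?_
    filter_upwards [Ioo_mem_nhdsGT (zero_lt_one (α := ℝ))] with t ht
    have hq1 : (γ x).1 ≤ q.1 := hq.1
    have hq2 : (γ x).2 ≤ q.2 := hq.2
    have ht0 := ht.1
    have ht1 := ht.2
    refine ⟨⟨?_, ?_⟩, fun u hu => ?_⟩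
    · show (γ x).1 ≤ q.1 - t * (q.1 - (γ x).1)
      nlinarith
    · show (γ x).2 ≤ q.2 - t * (q.2 - (γ x).2)
      nlinarith
    · simp only [Xsub, Finset.coe_filter, Set.mem_ofPred_eq] at hu
      obtain ⟨huX, hu⟩ := hu
      have hu1 : (γ u).1 ≤ q.1 - t * (q.1 - (γ x).1) := hu.1
      have hu2 : (γ u).2 ≤ q.2 - t * (q.2 - (γ x).2) := hu.2
      by_cases hux : u = x
      · rw [hux]
      have hne1 : (γ u).1 ≠ (γ x).1 := fun h => hux (hinj1 huX hx h)
      have hne2 : (γ u).2 ≠ (γ x).2 := fun h => hux (hinj2 huX hx h)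
      refine hw u huX ?_ ?_
      · show (γ u).1 < q.1
        rcases hq1.lt_or_eq with h | h
        · nlinarith
        · exact lt_of_le_of_ne (by nlinarith) (h ▸ hne1)
      · show (γ u).2 < q.2
        rcases hq2.lt_or_eq with h | h
        · nlinarith
        · exact lt_of_le_of_ne (by nlinarith) (h ▸ hne2)

/-- A point of `X` other than `x = max₁(σ)` and `y = max₂(σ)` lies in `X_{γ(σ)}` iff its grade
is strictly below `γ(σ)` in both coordinates. -/
theorem mem_Xsub_iff_lt {X : Finset (Pt d)} {γ : Pt d → ℝ × ℝ}
    (hinj1 : Set.InjOn (fun z => (γ z).1) (↑X : Set (Pt d)))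
    (hinj2 : Set.InjOn (fun z => (γ z).2) (↑X : Set (Pt d)))
    {x y u : Pt d} (hx : x ∈ X) (hy : y ∈ X) (hux : u ≠ x) (huy : u ≠ y) :
    u ∈ Xsub X γ ((γ x).1, (γ y).2) ↔ u ∈ X ∧ (γ u).1 < (γ x).1 ∧ (γ u).2 < (γ y).2 := by
  simp only [Xsub, Finset.mem_filter]
  refine and_congr_right fun hu => ⟨fun h => ⟨?_, ?_⟩, fun h => ⟨h.1.le, h.2.le⟩⟩
  · exact lt_of_le_of_ne h.1 fun h => hux (hinj1 hu hx h)
  · exact lt_of_le_of_ne h.2 fun h => huy (hinj2 hu hy h)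

/-- The minimum defining the incremental Delaunay radius is attained. -/
theorem exists_isWitness_omegaRad {X : Finset (Pt d)} {γ : Pt d → ℝ × ℝ}
    (hinj1 : Set.InjOn (fun z => (γ z).1) (↑X : Set (Pt d)))
    (hinj2 : Set.InjOn (fun z => (γ z).2) (↑X : Set (Pt d)))
    {σ : Finset (Pt d)} (hsub : σ ⊆ X) (hσ : σ ∈ Incr X γ) {x y : Pt d}
    (hx : IsMax1 γ σ x) (hy : IsMax2 γ σ y) :
    ∃ c, IsWitness X γ σ x y c (omegaRad X γ σ) := by
  have hset : {r | 0 ≤ r ∧ ∃ x y c, IsMax1 γ σ x ∧ IsMax2 γ σ y ∧ IsWitness X γ σ x y c r} =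
      {r | 0 ≤ r ∧ ∃ c, IsWitness X γ σ x y c r} := by
    ext r
    refine and_congr_right fun _ => ⟨?_, fun ⟨c, hc⟩ => ⟨x, y, c, hx, hy, hc⟩⟩
    rintro ⟨x', y', c, hx', hy', hc⟩
    obtain rfl : x' = x := hinj1 (hsub hx'.1) (hsub hx.1)
      (le_antisymm (hx.2 _ hx'.1) (hx'.2 _ hx.1))
    obtain rfl : y' = y := hinj2 (hsub hy'.1) (hsub hy.1)
      (le_antisymm (hy.2 _ hy'.1) (hy'.2 _ hy.1))
    exact ⟨c, hc⟩
  obtain ⟨-, -, x', y', c₀, r₀, hx', hy', hr₀, hc₀⟩ := hσ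
  have hr₀mem : r₀ ∈ {r | 0 ≤ r ∧ ∃ c, IsWitness X γ σ x y c r} :=
    hset ▸ ⟨hr₀, x', y', c₀, hx', hy', hc₀⟩
  have hclosed : IsClosed {z : Pt d × ℝ | IsWitness X γ σ x y z.1 z.2} := by
    unfold IsWitness
    refine IsClosed.and ?_ (IsClosed.and (isClosed_le (by fun_prop) (by fun_prop))
      (IsClosed.and (isClosed_le (by fun_prop) (by fun_prop)) ?_))
    · simp only [Set.ofPred_forall]
      exact isClosed_biInter fun u _ => isClosed_iInter fun _ => isClosed_iInter fun _ =>
        isClosed_eq (by fun_prop) (by fun_prop)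
    · simp only [Set.ofPred_forall, not_lt]
      exact isClosed_biInter fun u _ => isClosed_iInter fun _ => isClosed_iInter fun _ =>
        isClosed_le (by fun_prop) (by fun_prop)
  have hcompact : IsCompact ((Metric.closedBall x r₀ ×ˢ Set.Icc 0 r₀) ∩
      {z : Pt d × ℝ | IsWitness X γ σ x y z.1 z.2}) :=
    ((isCompact_closedBall x r₀).prod isCompact_Icc).inter_right hclosed
  have hball : ∀ {c r}, IsWitness X γ σ x y c r → r ≤ r₀ → c ∈ Metric.closedBall x r₀ :=
    fun hc hr => by
      rw [mem_closedBall_iff_norm']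
      exact hc.2.1.trans hr
  obtain ⟨hr₀nonneg, c₁, hc₁⟩ := hr₀mem
  obtain ⟨⟨c, ρ⟩, ⟨⟨-, hρ⟩, hc⟩, hmin⟩ := hcompact.exists_isMinOn
    ⟨(c₁, r₀), ⟨hball hc₁ le_rfl, hr₀nonneg, le_rfl⟩, hc₁⟩ continuous_snd.continuousOn
  have hleast : IsLeast {r | 0 ≤ r ∧ ∃ c, IsWitness X γ σ x y c r} ρ := by
    refine ⟨⟨hρ.1, c, hc⟩, ?_⟩
    rintro r ⟨hr, c', hc'⟩
    rcases le_total r r₀ with h | h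
    · exact hmin (show (c', r) ∈ _ from ⟨⟨hball hc' h, hr, h⟩, hc'⟩)
    · exact hρ.2.trans h
  refine ⟨c, ?_⟩
  rw [omegaRad, hset, hleast.csInf_eq]
  exact hc

/-- The intersection `⋂_{x ∈ σ} TelVor(x)_{p,r}` is nonempty iff `σ ∈ Incr(γ)`,
`γ(σ) ≤ p`, and `ω_σ ≤ r`. -/
theorem telVorIntersectionIffDel
    {d : ℕ} (hd : 1 ≤ d) (X : Finset (Pt d)) (γ : Pt d → ℝ × ℝ)
    (hgen : GenPos X)
    (hinj1 : Set.InjOn (fun z => (γ z).1) (↑X : Set (Pt d)))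
    (hinj2 : Set.InjOn (fun z => (γ z).2) (↑X : Set (Pt d)))
    (σ : Finset (Pt d)) (hne : σ.Nonempty) (hsub : σ ⊆ X)
    (p : ℝ × ℝ) (r : ℝ) (hr : 0 ≤ r) :
    (⋂ x ∈ σ, TelVor X γ x p r).Nonempty ↔
      σ ∈ Incr X γ ∧ gammaJoin γ σ hne ≤ p ∧ omegaRad X γ σ ≤ r := by
  obtain ⟨x, hxσ, hxmax⟩ := σ.exists_max_image (fun z => (γ z).1) hne
  obtain ⟨y, hyσ, hymax⟩ := σ.exists_max_image (fun z => (γ z).2) hne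
  have hx : IsMax1 γ σ x := ⟨hxσ, hxmax⟩
  have hy : IsMax2 γ σ y := ⟨hyσ, hymax⟩
  have hjoin : gammaJoin γ σ hne = ((γ x).1, (γ y).2) :=
    Prod.ext (le_antisymm (Finset.sup'_le hne _ hxmax) (Finset.le_sup' (fun z => (γ z).1) hxσ))
      (le_antisymm (Finset.sup'_le hne _ hymax) (Finset.le_sup' (fun z => (γ z).2) hyσ))
  rw [hjoin]
  constructor
  · rintro ⟨⟨w, q⟩, hwq⟩
    simp only [Set.mem_iInter] at hwq
    have hball : ∀ z ∈ σ, ‖z - w‖ ≤ r := fun z hz => mem_closedBall_iff_norm'.1 (hwq z hz).2.1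
    have hqp : q ≤ p := (hwq x hxσ).2.2
    have htel := fun z hz => (mem_Tel_iff hinj1 hinj2 (hsub hz) _).1 (hwq z hz).1
    have hxq : (γ x).1 ≤ q.1 := (htel x hxσ).1.1
    have hyq : (γ y).2 ≤ q.2 := (htel y hyσ).1.2
    have hnear : ∀ z ∈ σ, ∀ u ∈ Xsub X γ ((γ x).1, (γ y).2), u ≠ x → u ≠ y →
        ‖z - w‖ ≤ ‖u - w‖ := by
      intro z hz u hu hux huy
      obtain ⟨huX, hu1, hu2⟩ :=
        (mem_Xsub_iff_lt hinj1 hinj2 (hsub hxσ) (hsub hyσ) hux huy).1 hu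
      rw [norm_sub_rev z, norm_sub_rev u]
      exact (htel z hz).2 u huX (hu1.trans_le hxq) (hu2.trans_le hyq)
    have hXσ : ∀ z ∈ σ, z ∈ Xsub X γ ((γ x).1, (γ y).2) := fun z hz =>
      Finset.mem_filter.2 ⟨hsub hz, hxmax z hz, hymax z hz⟩
    obtain ⟨v, hvσ, hvmax⟩ := σ.exists_max_image (fun z => ‖z - w‖) hne
    have hwit : IsWitness X γ σ x y w ‖v - w‖ :=
      ⟨fun z hz hzx hzy => le_antisymm (hvmax z hz) (hnear v hvσ z (hXσ z hz) hzx hzy),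
        hvmax x hxσ, hvmax y hyσ,
        fun u hu hux huy => not_lt.2 (hnear v hvσ u hu hux huy)⟩
    refine ⟨⟨hne, hsub, x, y, w, _, hx, hy, norm_nonneg _, hwit⟩,
      ⟨hxq.trans hqp.1, hyq.trans hqp.2⟩, (csInf_le ⟨0, fun _ h => h.1⟩ ?_).trans (hball v hvσ)⟩
    exact ⟨norm_nonneg _, x, y, w, hx, hy, hwit⟩
  · rintro ⟨hσ, hp, hω⟩
    obtain ⟨c, hon, hcx, hcy, hempty⟩ := exists_isWitness_omegaRad hinj1 hinj2 hsub hσ hx hy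
    have hle : ∀ z ∈ σ, ‖z - c‖ ≤ omegaRad X γ σ := by
      intro z hz
      by_cases hzx : z = x
      · exact hzx ▸ hcx
      by_cases hzy : z = y
      · exact hzy ▸ hcy
      exact (hon z hz hzx hzy).le
    refine ⟨(c, ((γ x).1, (γ y).2)), Set.mem_iInter₂.2 fun z hz => ⟨?_, ?_, hp⟩⟩
    · refine (mem_Tel_iff hinj1 hinj2 (hsub hz) _).2
        ⟨⟨hxmax z hz, hymax z hz⟩, fun u hu hu1 hu2 => ?_⟩
      have hux : u ≠ x := fun h => hu1.ne (by rw [h])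
      have huy : u ≠ y := fun h => hu2.ne (by rw [h])
      have hfar := hempty u ((mem_Xsub_iff_lt hinj1 hinj2 (hsub hxσ) (hsub hyσ) hux huy).2
        ⟨hu, hu1, hu2⟩) hux huy
      show ‖c - z‖ ≤ ‖c - u‖
      rw [norm_sub_rev c, norm_sub_rev c]
      exact (hle z hz).trans (not_lt.1 hfar)
    · exact mem_closedBall_iff_norm'.2 ((hle z hz).trans hω)
end
end

section
/- Let X ⊆ ℝ^d be finite, γ : X → ℝ², p ∈ ℝ², r ≥ 0. Let OTelDC_{p,r} = {(w,v,q) ∈ ℝ^d × ℝ^d × ℝ² : q ≤ p and there exists x ∈ X_q with ‖x − w‖ ≤ r and v ∈ Vor(x,X_q)}, and let Offset_{p,r} = ⋃_{x ∈ X_p} Ball_r(x) ⊆ ℝ^d. Then the projection map OTelDC_{p,r} → Offset_{p,r}, (w,v,q) ↦ w, is a homotopy equivalence, with homotopy inverse w ↦ (w,w,p). -/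
noncomputable section

attribute [local instance] Classical.propDecidable

variable {d : ℕ}

/-- Two continuous maps into a subset of a topological vector space are homotopic if the segments
joining their values stay in that subset. -/
theorem ContinuousMap.homotopic_of_segment_subset {Y E : Type*} [TopologicalSpace Y]
    [AddCommGroup E] [Module ℝ E] [TopologicalSpace E] [IsTopologicalAddGroup E]
    [ContinuousSMul ℝ E] {s : Set E} (f g : C(Y, s))
    (h : ∀ y, segment ℝ (f y : E) (g y) ⊆ s) : f.Homotopic g := by
  refine ⟨⟨⟨fun ty => ⟨AffineMap.lineMap (f ty.2 : E) (g ty.2 : E) (ty.1 : ℝ), h ty.2 ?_⟩, ?_⟩,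
    fun y => ?_, fun y => ?_⟩⟩
  · rw [segment_eq_image_lineMap]
    exact Set.mem_image_of_mem _ ty.1.2
  · refine Continuous.subtype_mk ?_ _
    simp only [AffineMap.lineMap_apply_module]
    fun_prop
  · ext
    simp
  · ext
    simp

/-- Along the segment from `v` to `w`, the difference of the squared distances to two fixed points
varies affinely. -/
theorem norm_segment_sub_sq_sub {E : Type*} [NormedAddCommGroup E] [InnerProductSpace ℝ E]
    (v w x y : E) {a b : ℝ} (hab : a + b = 1) :
    ‖a • v + b • w - x‖ ^ 2 - ‖a • v + b • w - y‖ ^ 2 =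
      a * (‖v - x‖ ^ 2 - ‖v - y‖ ^ 2) + b * (‖w - x‖ ^ 2 - ‖w - y‖ ^ 2) := by
  simp only [norm_sub_sq_real, inner_add_left, real_inner_smul_left]
  linear_combination (‖y‖ ^ 2 - ‖x‖ ^ 2) * hab

theorem exists_mem_vorCell {Z : Finset (Pt d)} (hZ : Z.Nonempty) (v : Pt d) :
    ∃ x ∈ Z, v ∈ VorCell x (↑Z : Set (Pt d)) :=
  Z.exists_min_image (fun y => ‖v - y‖) hZ

/-- If `v` lies in the Voronoi cell of `x`, then every point of the segment from `v` to `w` lies in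
the Voronoi cell of a site that is at most as far from `w` as `x` is. -/
theorem exists_mem_vorCell_of_mem_segment {Z : Finset (Pt d)} {x v w u : Pt d} (hx : x ∈ Z)
    (hv : v ∈ VorCell x (↑Z : Set (Pt d))) (hu : u ∈ segment ℝ v w) :
    ∃ y ∈ Z, ‖y - w‖ ≤ ‖x - w‖ ∧ u ∈ VorCell y (↑Z : Set (Pt d)) := by
  obtain ⟨a, b, ha, hb, hab, rfl⟩ := hu
  rcases hb.eq_or_lt with rfl | hb
  · obtain rfl : a = 1 := by linarith
    exact ⟨x, hx, le_rfl, by simpa using hv⟩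
  obtain ⟨y, hy, hyu⟩ := exists_mem_vorCell ⟨x, hx⟩ (a • v + b • w)
  refine ⟨y, hy, ?_, hyu⟩
  rw [norm_sub_rev y, norm_sub_rev x]
  have hvxy : ‖v - x‖ ^ 2 ≤ ‖v - y‖ ^ 2 := by gcongr; exact hv y hy
  have huyx : ‖a • v + b • w - y‖ ^ 2 ≤ ‖a • v + b • w - x‖ ^ 2 := by gcongr; exact hyu x hx
  have hid := norm_segment_sub_sq_sub v w x y hab
  have hav : a * (‖v - x‖ ^ 2 - ‖v - y‖ ^ 2) ≤ 0 :=
    mul_nonpos_of_nonneg_of_nonpos ha (by linarith)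
  have hbw : 0 ≤ ‖w - x‖ ^ 2 - ‖w - y‖ ^ 2 := nonneg_of_mul_nonneg_right (by linarith) hb
  exact (sq_le_sq₀ (norm_nonneg _) (norm_nonneg _)).1 (by linarith)

theorem Xsub_mono (X : Finset (Pt d)) (γ : Pt d → ℝ × ℝ) {q p : ℝ × ℝ} (h : q ≤ p) :
    Xsub X γ q ⊆ Xsub X γ p :=
  Finset.monotone_filter_right X fun _ _ hz => hz.trans h

theorem mem_OffsetSet {X : Finset (Pt d)} {γ : Pt d → ℝ × ℝ} {p : ℝ × ℝ} {r : ℝ} {w : Pt d} :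
    w ∈ OffsetSet X γ p r ↔ ∃ x ∈ Xsub X γ p, ‖x - w‖ ≤ r := by
  simp [OffsetSet, dist_eq_norm, norm_sub_rev w]

theorem OffsetSet_mono (X : Finset (Pt d)) (γ : Pt d → ℝ × ℝ) {q p : ℝ × ℝ} (r : ℝ)
    (h : q ≤ p) : OffsetSet X γ q r ⊆ OffsetSet X γ p r :=
  Set.biUnion_subset_biUnion_left (Xsub_mono X γ h)

theorem fst_mem_OffsetSet_of_mem_OTelDCSet {X : Finset (Pt d)} {γ : Pt d → ℝ × ℝ} {p : ℝ × ℝ}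
    {r : ℝ} {z : Pt d × Pt d × (ℝ × ℝ)} (hz : z ∈ OTelDCSet X γ p r) :
    z.1 ∈ OffsetSet X γ z.2.2 r := by
  obtain ⟨-, x, hx, hxr, -⟩ := hz
  exact mem_OffsetSet.2 ⟨x, hx, hxr⟩

/-- The diagonal over the offset at `q ≤ p` is contained in `OTelDC_{p,r}`. -/
theorem diag_mem_OTelDCSet {X : Finset (Pt d)} {γ : Pt d → ℝ × ℝ} {q p : ℝ × ℝ} {r : ℝ}
    {w : Pt d} (hqp : q ≤ p) (hw : w ∈ OffsetSet X γ q r) : (w, w, q) ∈ OTelDCSet X γ p r := by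
  obtain ⟨x, hx, hxr⟩ := mem_OffsetSet.1 hw
  obtain ⟨y, hy, hyw⟩ := exists_mem_vorCell ⟨x, hx⟩ w
  refine ⟨hqp, y, hy, ?_, hyw⟩
  rw [norm_sub_rev] at hxr ⊢
  exact (hyw x hx).trans hxr

/-- Moving `v` to `w` along a segment stays inside `OTelDC_{p,r}`. -/
theorem segment_snd_subset_OTelDCSet {X : Finset (Pt d)} {γ : Pt d → ℝ × ℝ} {q p : ℝ × ℝ} {r : ℝ}
    {w v : Pt d} (h : (w, v, q) ∈ OTelDCSet X γ p r) :
    segment ℝ (w, w, q) (w, v, q) ⊆ OTelDCSet X γ p r := by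
  rw [← Prod.image_mk_segment_right, ← Prod.image_mk_segment_left, segment_symm]
  rintro _ ⟨_, ⟨u, hu, rfl⟩, rfl⟩
  obtain ⟨hqp, x, hx, hxr, hv⟩ := h
  obtain ⟨y, hy, hyw, hyu⟩ := exists_mem_vorCell_of_mem_segment hx hv hu
  exact ⟨hqp, y, hy, hyw.trans hxr, hyu⟩

/-- Moving `q` up to `p` on the diagonal stays inside `OTelDC_{p,r}`. -/
theorem segment_diag_subset_OTelDCSet {X : Finset (Pt d)} {γ : Pt d → ℝ × ℝ} {q p : ℝ × ℝ} {r : ℝ}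
    {w : Pt d} (hqp : q ≤ p) (hw : w ∈ OffsetSet X γ q r) :
    segment ℝ (w, w, p) (w, w, q) ⊆ OTelDCSet X γ p r := by
  rw [← Prod.image_mk_segment_right, ← Prod.image_mk_segment_right, segment_symm]
  rintro _ ⟨_, ⟨t, ht, rfl⟩, rfl⟩
  have hqtp := segment_subset_Icc hqp ht
  exact diag_mem_OTelDCSet hqtp.2 (OffsetSet_mono X γ r hqtp.1 hw)

/-- The projection `OTelDC_{p,r} → Offset_{p,r}`, `(w,v,q) ↦ w`, is a homotopy
equivalence, with homotopy inverse `w ↦ (w,w,p)`. -/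
theorem oTelDCProjHomotopyEquiv
    {d : ℕ} (hd : 1 ≤ d) (X : Finset (Pt d)) (γ : Pt d → ℝ × ℝ)
    (p : ℝ × ℝ) (r : ℝ) (hr : 0 ≤ r) :
    ∃ (f : C(↥(OTelDCSet X γ p r), ↥(OffsetSet X γ p r)))
      (g : C(↥(OffsetSet X γ p r), ↥(OTelDCSet X γ p r))),
      (∀ z : ↥(OTelDCSet X γ p r), (f z : Pt d) = (z : Pt d × Pt d × (ℝ × ℝ)).1) ∧
      (∀ w : ↥(OffsetSet X γ p r),
        (g w : Pt d × Pt d × (ℝ × ℝ)) = ((w : Pt d), (w : Pt d), p)) ∧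
      (f.comp g).Homotopic (ContinuousMap.id ↥(OffsetSet X γ p r)) ∧
      (g.comp f).Homotopic (ContinuousMap.id ↥(OTelDCSet X γ p r)) := by
  have hmem (z : OTelDCSet X γ p r) := fst_mem_OffsetSet_of_mem_OTelDCSet z.2
  let f : C(OTelDCSet X γ p r, OffsetSet X γ p r) :=
    ⟨fun z => ⟨z.1.1, OffsetSet_mono X γ r z.2.1 (hmem z)⟩, by fun_prop⟩
  let g : C(OffsetSet X γ p r, OTelDCSet X γ p r) :=
    ⟨fun w => ⟨(w, w, p), diag_mem_OTelDCSet le_rfl w.2⟩, by fun_prop⟩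
  let k : C(OTelDCSet X γ p r, OTelDCSet X γ p r) :=
    ⟨fun z => ⟨(z.1.1, z.1.1, z.1.2.2), diag_mem_OTelDCSet z.2.1 (hmem z)⟩, by fun_prop⟩
  refine ⟨f, g, fun _ => rfl, fun _ => rfl, .refl _, .trans (g := k) ?_ ?_⟩
  · exact ContinuousMap.homotopic_of_segment_subset _ _ fun z =>
      segment_diag_subset_OTelDCSet z.2.1 (hmem z)
  · exact ContinuousMap.homotopic_of_segment_subset _ _ fun z =>
      segment_snd_subset_OTelDCSet z.2
end
end
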